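/- arXiv:2007.10493 — 3 statements merged into one kernel-verified Lean document; each statement's English description precedes it below -/
import Mathlib

section
/- Let X be a real-valued random variable with E[X] = μ and E[|X|^{1+ε}] ≤ u^{1+ε} for some ε ∈ (0,1] and u > 0. For any B > 0, the saturated mean satisfies |E[sat(X,B)] − μ| ≤ u^{1+ε}/B^ε. -/
open MeasureTheory Real

/-- `sat(x,B) := sign(x) · min(|x|, B)`. -/
noncomputable def sat (x B : ℝ) : ℝ := Real.sign x * min |x| B

theorem sat_eq_clip (x B : ℝ) (hB : 0 < B) : sat x B = max (-B) (min x B) := by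
  unfold sat
  rcases lt_trichotomy x 0 with h | h | h
  · rw [Real.sign_of_neg h, abs_of_neg h, min_eq_left (by linarith : x ≤ B)]
    rcases le_total (-x) B with h1 | h1
    · rw [min_eq_left h1, max_eq_right (by linarith)]; ring
    · rw [min_eq_right h1, max_eq_left (by linarith)]; ring
  · subst h
    simp [hB.le]
  · rw [Real.sign_of_pos h, abs_of_pos h, one_mul, max_eq_right]
    exact le_min (by linarith) (by linarith)

theorem sat_sub_bound (x B ε : ℝ) (hB : 0 < B) (hε : 0 < ε) :
    |sat x B - x| ≤ |x| ^ (1 + ε) / B ^ ε := by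
  rw [sat_eq_clip x B hB]
  have hBe : 0 < B ^ ε := Real.rpow_pos_of_pos hB ε
  by_cases h : |x| ≤ B
  · obtain ⟨h1, h2⟩ := abs_le.mp h
    rw [min_eq_left h2, max_eq_right h1, sub_self, abs_zero]
    positivity
  · push Not at h
    have hx : 0 < |x| := hB.trans h
    have h1 : |max (-B) (min x B) - x| ≤ |x| := by
      rcases le_total 0 x with h0 | h0
      · rw [abs_of_nonneg h0] at *
        rw [min_eq_right h.le, max_eq_right (by linarith), abs_le]
        constructor <;> linarith
      · rw [abs_of_nonpos h0] at *
        rw [min_eq_left (by linarith), max_eq_left (by linarith), abs_le]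
        constructor <;> linarith
    refine h1.trans ?_
    rw [le_div_iff₀ hBe, Real.rpow_add hx, Real.rpow_one]
    exact mul_le_mul_of_nonneg_left (Real.rpow_le_rpow hB.le h.le hε.le) hx.le

/-- **Bias bound for the saturated mean.**
If `E[X] = μ` and `E[|X|^{1+ε}] ≤ u^{1+ε}` with `ε ∈ (0,1]`, `u > 0`, then for any `B > 0`,
`|E[sat(X,B)] − μ| ≤ u^{1+ε} / B^ε`. -/
theorem saturated_mean_bias
    {Ω : Type*} [MeasurableSpace Ω] (ℙ : Measure Ω) [IsProbabilityMeasure ℙ]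
    (X : Ω → ℝ) (hXmeas : Measurable X)
    (μ u ε B : ℝ) (hε : ε ∈ Set.Ioc (0 : ℝ) 1) (hu : 0 < u) (hB : 0 < B)
    (hXint : Integrable X ℙ) (hmean : ∫ ω, X ω ∂ℙ = μ)
    (hmomint : Integrable (fun ω => |X ω| ^ (1 + ε)) ℙ)
    (hmom : ∫ ω, |X ω| ^ (1 + ε) ∂ℙ ≤ u ^ (1 + ε)) :
    |(∫ ω, sat (X ω) B ∂ℙ) - μ| ≤ u ^ (1 + ε) / B ^ ε := by
  have hBe : 0 < B ^ ε := Real.rpow_pos_of_pos hB ε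
  have hsat : Integrable (fun ω => sat (X ω) B) ℙ := by
    simp only [fun ω => sat_eq_clip (X ω) B hB]
    exact (integrable_const (-B)).sup (hXint.inf (integrable_const B))
  rw [← hmean, ← integral_sub hsat hXint]
  calc |∫ ω, (sat (X ω) B - X ω) ∂ℙ| ≤ ∫ ω, |sat (X ω) B - X ω| ∂ℙ :=
        abs_integral_le_integral_abs
    _ ≤ ∫ ω, |X ω| ^ (1 + ε) / B ^ ε ∂ℙ :=
        integral_mono (hsat.sub hXint).abs (hmomint.div_const _)
          (fun ω => sat_sub_bound (X ω) B ε hB hε.1)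
    _ = (∫ ω, |X ω| ^ (1 + ε) ∂ℙ) / B ^ ε := integral_div _ _
    _ ≤ u ^ (1 + ε) / B ^ ε := div_le_div_of_nonneg_right hmom hBe.le
end

section
/- For every a > 1, b > 0 and ε ∈ (0,1], the series Σ_{s=1}^∞ a^s·exp(−b·a^{εs/(1+ε)}) converges and is at most (a/ln a)·Γ(1/ε + 2)·b^{−(1+ε)/ε}. -/
open Real

/-- For every `a > 1`, `b > 0` and `ε ∈ (0,1]`, the series
`Σ_{s=1}^∞ a^s·exp(−b·a^{εs/(1+ε)})` converges and is at most
`(a/ln a)·Γ(1/ε + 2)·b^{−(1+ε)/ε}`. -/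
theorem geometric_peeling_sum_bound (a b ε : ℝ) (ha : 1 < a) (hb : 0 < b)
    (hε : ε ∈ Set.Ioc (0 : ℝ) 1) :
    Summable (fun s : ℕ => a ^ (s + 1) * Real.exp (-b * a ^ (ε * (s + 1 : ℕ) / (1 + ε)))) ∧
    ∑' s : ℕ, a ^ (s + 1) * Real.exp (-b * a ^ (ε * (s + 1 : ℕ) / (1 + ε))) ≤
      (a / Real.log a) * Real.Gamma (1 / ε + 2) * b ^ (-((1 + ε) / ε)) := by
  obtain ⟨h0, -⟩ := hε
  have ha0 : 0 < a := by linarith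
  have hlog : 0 < Real.log a := Real.log_pos ha
  have hlog1 : Real.log a ≤ a - 1 := Real.log_le_sub_one_of_pos ha0
  set p : ℝ := ε / (1 + ε) with hp
  have hp0 : 0 < p := by positivity
  have hI := integral_exp_neg_mul_rpow hp0 hb
  have e1 : -1 / p = -((1 + ε) / ε) := by rw [hp]; field_simp
  have e2 : 1 / p + 1 = 1 / ε + 2 := by rw [hp]; field_simp; ring
  rw [e1, e2] at hI
  have hGpos : 0 < Real.Gamma (1 / ε + 2) := Real.Gamma_pos_of_pos (by positivity)
  have hint : MeasureTheory.IntegrableOn (fun x : ℝ => Real.exp (-b * x ^ p)) (Set.Ioi 0) := by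
    by_contra h
    have h2 := MeasureTheory.integral_undef h
    rw [hI] at h2
    have : 0 < b ^ (-((1 + ε) / ε)) * Real.Gamma (1 / ε + 2) := by positivity
    linarith
  have hii : ∀ x y : ℝ, 0 ≤ x → 0 ≤ y → IntervalIntegrable (fun x : ℝ => Real.exp (-b * x ^ p))
      MeasureTheory.volume x y := by
    intro x y _ _
    apply Continuous.intervalIntegrable
    have : Continuous (fun x : ℝ => x ^ p) := Real.continuous_rpow_const hp0.le
    fun_prop
  have hterm : ∀ s : ℕ, a ^ (s + 1) * Real.exp (-b * a ^ (ε * (s + 1 : ℕ) / (1 + ε))) ≤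
      (a / Real.log a) * ∫ x in (a ^ s)..(a ^ (s + 1)), Real.exp (-b * x ^ p) := by
    intro s
    have hle : a ^ s ≤ a ^ (s + 1) := pow_le_pow_right₀ ha.le (Nat.le_succ s)
    have e3 : a ^ (ε * (s + 1 : ℕ) / (1 + ε)) = (a ^ (s + 1)) ^ p := by
      rw [← Real.rpow_natCast a (s + 1), ← Real.rpow_mul ha0.le]
      congr 1
      rw [hp]; ring
    rw [e3]
    have hps : 0 < a ^ s := by positivity
    have hlow : (a ^ (s + 1) - a ^ s) * Real.exp (-b * (a ^ (s + 1)) ^ p) ≤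
        ∫ x in (a ^ s)..(a ^ (s + 1)), Real.exp (-b * x ^ p) := by
      rw [← smul_eq_mul, ← intervalIntegral.integral_const]
      apply intervalIntegral.integral_mono_on hle (by simp) (hii _ _ hps.le (by positivity))
      intro x hx
      apply Real.exp_le_exp.mpr
      have : x ^ p ≤ (a ^ (s + 1)) ^ p :=
        Real.rpow_le_rpow (hps.le.trans hx.1) hx.2 hp0.le
      nlinarith
    refine le_trans ?_ (mul_le_mul_of_nonneg_left hlow (by positivity))
    rw [← mul_assoc]
    apply mul_le_mul_of_nonneg_right _ (Real.exp_pos _).le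
    rw [div_mul_eq_mul_div, le_div_iff₀ hlog, pow_succ]
    have : a ^ s * a * Real.log a ≤ a ^ s * a * (a - 1) :=
      mul_le_mul_of_nonneg_left hlog1 (by positivity)
    linarith
  have hpart : ∀ n : ℕ, ∑ s ∈ Finset.range n,
      a ^ (s + 1) * Real.exp (-b * a ^ (ε * (s + 1 : ℕ) / (1 + ε))) ≤
      (a / Real.log a) * Real.Gamma (1 / ε + 2) * b ^ (-((1 + ε) / ε)) := by
    intro n
    refine (Finset.sum_le_sum fun s _ => hterm s).trans ?_
    rw [← Finset.mul_sum, intervalIntegral.sum_integral_adjacent_intervals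
      (fun k _ => hii _ _ (by positivity) (by positivity)), mul_assoc]
    apply mul_le_mul_of_nonneg_left _ (by positivity)
    rw [mul_comm, ← hI, intervalIntegral.integral_of_le (pow_le_pow_right₀ ha.le (Nat.zero_le n))]
    apply MeasureTheory.setIntegral_mono_set hint
    · exact Filter.Eventually.of_forall fun x => (Real.exp_pos _).le
    · apply Filter.Eventually.of_forall
      intro x hx
      exact lt_trans (by positivity) hx.1
  have hnn : ∀ s : ℕ, 0 ≤ a ^ (s + 1) * Real.exp (-b * a ^ (ε * (s + 1 : ℕ) / (1 + ε))) :=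
    fun s => by positivity
  exact ⟨summable_of_sum_range_le hnn hpart, Real.tsum_le_of_sum_range_le hnn hpart⟩
end

section
/- Fix ε ∈ (0,1], η > 0, positive integers T and K, and a real Δ with Δ ≥ (6+3η)·(e·K/T)^{ε/(1+ε)} and Δ ≤ 2. Let l := ⌈((6+3η)/Δ)^{(1+ε)/ε}·ln( (T/K)·(Δ/(6+3η))^{(1+ε)/ε} )⌉. Then l ≥ ((6+3η)/Δ)^{(1+ε)/ε}, and for every integer m ≥ l, c_m := [φ(m)]^{ε/(1+ε)} ≤ Δ/(6+3η), where φ(n) := ln_+(T/(K n))/n. -/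
open Real

/-- `ln_+(x) := max(ln x, 1)`. -/
noncomputable def lnplus (x : ℝ) : ℝ := max (Real.log x) 1

/-- `φ(n) := ln_+(T/(K n))/n`. -/
noncomputable def phi (T K : ℕ) (n : ℕ) : ℝ := lnplus ((T : ℝ) / (K * n)) / n

/-- With `Δ ≥ (6+3η)·(e·K/T)^{ε/(1+ε)}` and `Δ ≤ 2`, the number of samples
`l := ⌈((6+3η)/Δ)^{(1+ε)/ε}·ln((T/K)·(Δ/(6+3η))^{(1+ε)/ε})⌉` satisfies
`l ≥ ((6+3η)/Δ)^{(1+ε)/ε}`, and for every integer `m ≥ l`,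
`c_m = [φ(m)]^{ε/(1+ε)} ≤ Δ/(6+3η)` (the scale `u` is normalized to `1`). -/
theorem sufficient_sample_size (ε η : ℝ) (T K : ℕ) (Δ : ℝ)
    (hε : ε ∈ Set.Ioc (0 : ℝ) 1) (hη : 0 < η) (hT : 0 < T) (hK : 0 < K)
    (hΔlb : (6 + 3 * η) * (Real.exp 1 * K / T) ^ (ε / (1 + ε)) ≤ Δ) (hΔub : Δ ≤ 2)
    (l : ℕ)
    (hl : l = ⌈((6 + 3 * η) / Δ) ^ ((1 + ε) / ε) *
        Real.log ((T : ℝ) / K * (Δ / (6 + 3 * η)) ^ ((1 + ε) / ε))⌉₊) :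
    ((6 + 3 * η) / Δ) ^ ((1 + ε) / ε) ≤ (l : ℝ) ∧
    ∀ m : ℕ, l ≤ m → (phi T K m) ^ (ε / (1 + ε)) ≤ Δ / (6 + 3 * η) := by
  obtain ⟨hε0, hε1⟩ := hε
  have hp : 0 < (1 + ε) / ε := by positivity
  have hc : 0 < 6 + 3 * η := by positivity
  have hTr : (0 : ℝ) < T := by exact_mod_cast hT
  have hKr : (0 : ℝ) < K := by exact_mod_cast hK
  have hΔ : 0 < Δ := lt_of_lt_of_le (by positivity) hΔlb
  have hpq : ε / (1 + ε) = ((1 + ε) / ε)⁻¹ := by rw [inv_div]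
  rw [hpq] at hΔlb ⊢
  generalize (1 + ε) / ε = p at *
  have hd : 0 < Δ / (6 + 3 * η) := by positivity
  have hinv : (6 + 3 * η) / Δ = (Δ / (6 + 3 * η))⁻¹ := by rw [inv_div]
  have hlb : (Real.exp 1 * K / T) ^ p⁻¹ ≤ Δ / (6 + 3 * η) := by
    rw [le_div_iff₀ hc]; linarith
  rw [hinv] at hl ⊢
  generalize Δ / (6 + 3 * η) = d at *
  have hlb2 : Real.exp 1 * K / T ≤ d ^ p :=
    (Real.rpow_inv_le_iff_of_pos (by positivity) hd.le hp).1 hlb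
  rw [Real.inv_rpow hd.le] at hl ⊢
  have hD : 0 < d ^ p := by positivity
  have hlog : 1 ≤ Real.log ((T : ℝ) / K * d ^ p) := by
    rw [Real.le_log_iff_exp_le (by positivity)]
    rw [div_le_iff₀ hTr] at hlb2
    rw [div_mul_eq_mul_div, le_div_iff₀ hKr]
    linarith
  have hL : (d ^ p)⁻¹ * Real.log ((T : ℝ) / K * d ^ p) ≤ l := by
    rw [hl]; exact Nat.le_ceil _
  have hl1 : (d ^ p)⁻¹ ≤ (l : ℝ) :=
    le_trans (le_mul_of_one_le_right (by positivity) hlog) hL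
  refine ⟨hl1, fun m hm => ?_⟩
  have hm' : (l : ℝ) ≤ m := by exact_mod_cast hm
  have hA : (d ^ p)⁻¹ ≤ (m : ℝ) := hl1.trans hm'
  have hm0 : (0 : ℝ) < m := lt_of_lt_of_le (by positivity) hA
  have h1 : 1 ≤ d ^ p * m := by
    rwa [inv_le_iff_one_le_mul₀' hD] at hA
  have hlm : Real.log ((T : ℝ) / K * d ^ p) ≤ d ^ p * m := by
    have := hL.trans hm'
    rwa [inv_mul_le_iff₀ hD] at this
  have hphi0 : 0 ≤ phi T K m := by
    unfold phi lnplus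
    exact div_nonneg (le_trans zero_le_one (le_max_right _ _)) hm0.le
  rw [Real.rpow_inv_le_iff_of_pos hphi0 hd.le hp]
  unfold phi lnplus
  rw [div_le_iff₀ hm0]
  refine max_le (le_trans (Real.log_le_log (by positivity) ?_) hlm) h1
  rw [← div_div, div_le_iff₀ hm0, mul_assoc]
  exact le_mul_of_one_le_right (by positivity) h1
end
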